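/- Let p be an odd prime and q = p^a with q ≡ 1 (mod 4) and q ∉ {5, 29}. Let K = 𝔽_q((u)), O = 𝔽_q[[u]], and let P₁, P₂ and B = P₁ ∩ P₂ be the standard parahoric and Iwahori subgroups of SL₂(K). Then there do not exist finite subgroups A₁ ≤ P₁ and A₂ ≤ P₂ such that, for i = 1,2, every element of P_i can be written as a·b with a ∈ A_i and b ∈ B, and A_i ∩ P_{3-i} = A₁ ∩ A₂. -/

import Mathlib

/-- The valuation ring `O = 𝔽_q[[u]]` of `K = 𝔽_q((u))`, regarded as a subring of `K`
(the image of the ring of formal power series). -/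
noncomputable def laurentIntegers (F : Type*) [Field F] : Subring (LaurentSeries F) :=
  (HahnSeries.ofPowerSeries ℤ F).range

/-- The uniformiser `u` of `K = 𝔽_q((u))`. -/
noncomputable def laurentVar (F : Type*) [Field F] : LaurentSeries F :=
  HahnSeries.ofPowerSeries ℤ F PowerSeries.X

/-- The standard parahoric subgroup `P₁` of `SL₂(K)`: matrices all of whose entries lie
in `O`. -/
def parahoricOne (F : Type*) [Field F] :
    Set (Matrix.SpecialLinearGroup (Fin 2) (LaurentSeries F)) :=
  {g | ∀ i j : Fin 2, (↑g : Matrix (Fin 2) (Fin 2) (LaurentSeries F)) i j ∈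
    laurentIntegers F}

/-- The standard parahoric subgroup `P₂` of `SL₂(K)`: matrices whose diagonal entries lie
in `O`, with `u` times the top-right entry in `O`, and bottom-left entry in `u·O`. -/
def parahoricTwo (F : Type*) [Field F] :
    Set (Matrix.SpecialLinearGroup (Fin 2) (LaurentSeries F)) :=
  {g | (↑g : Matrix (Fin 2) (Fin 2) (LaurentSeries F)) 0 0 ∈ laurentIntegers F ∧
       (↑g : Matrix (Fin 2) (Fin 2) (LaurentSeries F)) 1 1 ∈ laurentIntegers F ∧
       laurentVar F * (↑g : Matrix (Fin 2) (Fin 2) (LaurentSeries F)) 0 1 ∈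
         laurentIntegers F ∧
       ∃ y ∈ laurentIntegers F,
         (↑g : Matrix (Fin 2) (Fin 2) (LaurentSeries F)) 1 0 = laurentVar F * y}

/-- The Iwahori subgroup `B = P₁ ∩ P₂`. -/
def iwahori (F : Type*) [Field F] :
    Set (Matrix.SpecialLinearGroup (Fin 2) (LaurentSeries F)) :=
  parahoricOne F ∩ parahoricTwo F

section

open scoped MatrixGroups

section NormalForm

variable {G : Type*} [Group G]

/-- `AlternatingProduct A i g` says that `g` is a product of elements alternately taken from
`A true \ A false` and `A false \ A true`, times an element of the intersection, whose leftmost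
letter, if there is one, does not come from `A i`. -/
inductive AlternatingProduct (A : Bool → Subgroup G) : Bool → G → Prop
  | of_mem {i : Bool} {a : G} : (∀ j, a ∈ A j) → AlternatingProduct A i a
  | mul {i : Bool} {a g : G} : a ∈ A i → a ∉ A (!i) → AlternatingProduct A i g →
      AlternatingProduct A (!i) (a * g)

namespace AlternatingProduct

variable {A : Bool → Subgroup G} {i : Bool} {a g : G}

lemma mul_left_of_forall_mem (h : AlternatingProduct A i g) (ha : ∀ j, a ∈ A j) :
    AlternatingProduct A i (a * g) := by
  cases h with
  | of_mem hg => exact .of_mem fun j ↦ mul_mem (ha j) (hg j)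
  | @mul k b g hb hb' hg =>
    rw [← mul_assoc]
    exact .mul (mul_mem (ha _) hb) (fun h ↦ hb' ((Subgroup.mul_mem_cancel_left _ (ha _)).1 h)) hg

lemma exists_mul_left_of_mem (h : AlternatingProduct A i g) {j : Bool} (ha : a ∈ A j) :
    ∃ k, AlternatingProduct A k (a * g) := by
  by_cases ha' : a ∈ A (!j)
  · exact ⟨i, h.mul_left_of_forall_mem fun k ↦ by cases j <;> cases k <;> simp_all⟩
  · by_cases hij : i = j
    · subst hij
      exact ⟨_, .mul ha ha' h⟩
    · cases h with
      | of_mem hg => exact ⟨_, .mul ha ha' (.of_mem hg)⟩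
      | @mul k b g hb hb' hg =>
        obtain rfl : k = j := by cases k <;> cases j <;> simp_all
        rw [← mul_assoc]
        by_cases hab : a * b ∈ A (!k)
        · refine ⟨k, hg.mul_left_of_forall_mem fun l ↦ ?_⟩
          have := mul_mem ha hb
          cases l <;> cases k <;> simp_all
        · exact ⟨_, .mul (mul_mem ha hb) hab hg⟩

lemma exists_of_mem_sup (hg : g ∈ A true ⊔ A false) : ∃ i, AlternatingProduct A i g := by
  rw [Subgroup.sup_eq_closure] at hg
  induction hg using Subgroup.closure_induction_left with
  | one => exact ⟨true, .of_mem fun j ↦ one_mem _⟩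
  | mul_left x hx y _ ih =>
    obtain ⟨i, hi⟩ := ih
    rcases hx with hx | hx <;> exact hi.exists_mul_left_of_mem hx
  | inv_mul_cancel x hx y _ ih =>
    obtain ⟨i, hi⟩ := ih
    rcases hx with hx | hx <;> exact hi.exists_mul_left_of_mem (inv_mem hx)

end AlternatingProduct

end NormalForm

section Parahoric

variable {K : Type*} [Field K] (v : AddValuation K (WithTop ℤ))

/-- The matrices in `SL₂` with entries in the valuation ring. -/
def parahoricOneOf : Subgroup (SL(2, K)) where
  carrier := {g | 0 ≤ v (g 0 0) ∧ 0 ≤ v (g 0 1) ∧ 0 ≤ v (g 1 0) ∧ 0 ≤ v (g 1 1)}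
  one_mem' := by simp
  mul_mem' := by
    rintro g h ⟨h1, h2, h3, h4⟩ ⟨k1, k2, k3, k4⟩
    simp only [Set.mem_ofPred_eq, Matrix.SpecialLinearGroup.coe_mul, Matrix.mul_apply, Fin.sum_univ_two]
    refine ⟨?_, ?_, ?_, ?_⟩ <;> refine AddValuation.map_le_add _ ?_ ?_ <;>
    · rw [AddValuation.map_mul]
      exact add_nonneg ‹_› ‹_›
  inv_mem' := by
    rintro g ⟨h1, h2, h3, h4⟩
    simp only [Set.mem_ofPred_eq, Matrix.SpecialLinearGroup.coe_inv, Matrix.adjugate_fin_two]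
    simpa using ⟨h4, h2, h3, h1⟩

/-- The matrices in `SL₂` with diagonal entries of nonnegative valuation, upper right entry of
valuation at least `-1`, and lower left entry of valuation at least `1`. -/
def parahoricTwoOf : Subgroup (SL(2, K)) where
  carrier := {g | 0 ≤ v (g 0 0) ∧ ((-1 : ℤ) : WithTop ℤ) ≤ v (g 0 1) ∧
    ((1 : ℤ) : WithTop ℤ) ≤ v (g 1 0) ∧ 0 ≤ v (g 1 1)}
  one_mem' := by simp
  mul_mem' := by
    rintro g h ⟨h1, h2, h3, h4⟩ ⟨k1, k2, k3, k4⟩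
    simp only [Set.mem_ofPred_eq, Matrix.SpecialLinearGroup.coe_mul, Matrix.mul_apply, Fin.sum_univ_two]
    refine ⟨?_, ?_, ?_, ?_⟩ <;> refine AddValuation.map_le_add _ ?_ ?_ <;> rw [AddValuation.map_mul]
    · exact add_nonneg h1 k1
    · simpa using add_le_add h2 k3
    · simpa using add_le_add h1 k2
    · simpa using add_le_add h2 k4
    · simpa using add_le_add h3 k1
    · simpa using add_le_add h4 k3
    · simpa using add_le_add h3 k2
    · exact add_nonneg h4 k4
  inv_mem' := by
    rintro g ⟨h1, h2, h3, h4⟩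
    simp only [Set.mem_ofPred_eq, Matrix.SpecialLinearGroup.coe_inv, Matrix.adjugate_fin_two]
    simpa using ⟨h4, h2, h3, h1⟩

variable {v}

lemma mem_parahoricOneOf {g : SL(2, K)} : g ∈ parahoricOneOf v ↔
    0 ≤ v (g 0 0) ∧ 0 ≤ v (g 0 1) ∧ 0 ≤ v (g 1 0) ∧ 0 ≤ v (g 1 1) := Iff.rfl

lemma mem_parahoricTwoOf {g : SL(2, K)} : g ∈ parahoricTwoOf v ↔
    0 ≤ v (g 0 0) ∧ ((-1 : ℤ) : WithTop ℤ) ≤ v (g 0 1) ∧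
      ((1 : ℤ) : WithTop ℤ) ≤ v (g 1 0) ∧ 0 ≤ v (g 1 1) := Iff.rfl

lemma map_mul_add_of_eq_zero {a b c d x y : K} (ha : 0 ≤ v a) (hb : 0 ≤ v b) (hc : v c = 0)
    (hd : 0 ≤ v d) (hxy : v x < v y) :
    v (c * x + d * y) = v x ∧ v x ≤ v (a * x + b * y) := by
  constructor
  · rw [AddValuation.map_add_eq_of_lt_left, AddValuation.map_mul, hc, zero_add]
    rw [AddValuation.map_mul, AddValuation.map_mul, hc, zero_add]
    exact hxy.trans_le (le_add_of_nonneg_left hd)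
  · refine AddValuation.map_le_add _ ?_ ?_ <;> rw [AddValuation.map_mul]
    · exact le_add_of_nonneg_left ha
    · exact hxy.le.trans (le_add_of_nonneg_left hb)

lemma map_mul_add_lt_of_eq_neg_one {a b c d x y : K} (ha : 0 ≤ v a)
    (hb : v b = ((-1 : ℤ) : WithTop ℤ)) (hc : ((1 : ℤ) : WithTop ℤ) ≤ v c) (hd : 0 ≤ v d)
    (hy : v y ≤ 0) (hxy : v y ≤ v x) :
    v (a * x + b * y) < v (c * x + d * y) ∧ v (a * x + b * y) < 0 := by
  have hlt : v (b * y) < v y := by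
    rw [AddValuation.map_mul, hb]
    generalize v y = t at *
    cases t with
    | top => simp at hy
    | coe t => norm_cast; omega
  have h : v (a * x + b * y) = v (b * y) := by
    apply AddValuation.map_add_eq_of_lt_right
    rw [AddValuation.map_mul v a]
    exact hlt.trans_le (hxy.trans (le_add_of_nonneg_left ha))
  rw [h]
  refine ⟨hlt.trans_le (AddValuation.map_le_add _ ?_ ?_), hlt.trans_le hy⟩ <;>
    rw [AddValuation.map_mul]
  · exact hxy.trans (le_add_of_nonneg_left (le_trans (by norm_cast) hc))
  · exact le_add_of_nonneg_left hd

/-- The region of `SL₂` containing the alternating products that start in the stabiliser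
`P₁ \ P₂` (for `true`) or `P₂ \ P₁` (for `false`). -/
def pingPongRegion (v : AddValuation K (WithTop ℤ)) :
    Bool → Set (SL(2, K))
  | true => {g | (v (g 1 0) ≤ v (g 0 0) ∧ v (g 1 0) ≤ 0) ∨ (v (g 1 1) ≤ v (g 0 1) ∧ v (g 1 1) < 0)}
  | false => {g | (v (g 0 0) < v (g 1 0) ∧ v (g 0 0) < 0) ∨ (v (g 0 1) < v (g 1 1) ∧ v (g 0 1) < 0)}

lemma map_eq_zero_of_notMem {g : SL(2, K)} (h1 : g ∈ parahoricOneOf v)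
    (h2 : g ∉ parahoricTwoOf v) : v (g 1 0) = 0 := by
  obtain ⟨ha, hb, hc, hd⟩ := h1
  have : ¬ ((1 : ℤ) : WithTop ℤ) ≤ v (g 1 0) := fun h ↦
    h2 ⟨ha, le_trans (by norm_cast) hb, h, hd⟩
  generalize v (g 1 0) = t at *
  cases t with
  | top => simp at this
  | coe t => norm_cast at *; omega

lemma map_eq_neg_one_of_notMem {g : SL(2, K)} (h2 : g ∈ parahoricTwoOf v)
    (h1 : g ∉ parahoricOneOf v) : v (g 0 1) = ((-1 : ℤ) : WithTop ℤ) := by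
  obtain ⟨ha, hb, hc, hd⟩ := h2
  have : ¬ 0 ≤ v (g 0 1) := fun h ↦
    h1 ⟨ha, h, le_trans (by norm_cast) hc, hd⟩
  generalize v (g 0 1) = t at *
  cases t with
  | top => simp at this
  | coe t => norm_cast at *; omega

lemma mem_pingPongRegion_true {g : SL(2, K)} (h1 : g ∈ parahoricOneOf v)
    (h2 : g ∉ parahoricTwoOf v) : g ∈ pingPongRegion v true := by
  have := map_eq_zero_of_notMem h1 h2
  exact .inl ⟨this.trans_le h1.1, this.le⟩

lemma mem_pingPongRegion_false {g : SL(2, K)} (h2 : g ∈ parahoricTwoOf v)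
    (h1 : g ∉ parahoricOneOf v) : g ∈ pingPongRegion v false := by
  have := map_eq_neg_one_of_notMem h2 h1
  have h0 : v (g 0 1) < 0 := this.trans_lt (by norm_cast)
  exact .inr ⟨h0.trans_le h2.2.2.2, h0⟩

lemma mul_mem_pingPongRegion_true {g h : SL(2, K)}
    (h1 : g ∈ parahoricOneOf v) (h2 : g ∉ parahoricTwoOf v) (hh : h ∈ pingPongRegion v false) :
    g * h ∈ pingPongRegion v true := by
  have hc := map_eq_zero_of_notMem h1 h2
  obtain ⟨ha, hb, -, hd⟩ := h1
  simp only [pingPongRegion, Set.mem_ofPred_eq, Matrix.SpecialLinearGroup.coe_mul, Matrix.mul_apply,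
    Fin.sum_univ_two] at hh ⊢
  rcases hh with ⟨hlt, h0⟩ | ⟨hlt, h0⟩
  · obtain ⟨e, f⟩ := map_mul_add_of_eq_zero ha hb hc hd hlt
    exact .inl ⟨e.trans_le f, e.trans_le h0.le⟩
  · obtain ⟨e, f⟩ := map_mul_add_of_eq_zero ha hb hc hd hlt
    exact .inr ⟨e.trans_le f, e.trans_lt h0⟩

lemma mul_mem_pingPongRegion_false {g h : SL(2, K)}
    (h2 : g ∈ parahoricTwoOf v) (h1 : g ∉ parahoricOneOf v) (hh : h ∈ pingPongRegion v true) :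
    g * h ∈ pingPongRegion v false := by
  have hb := map_eq_neg_one_of_notMem h2 h1
  obtain ⟨ha, -, hc, hd⟩ := h2
  simp only [pingPongRegion, Set.mem_ofPred_eq, Matrix.SpecialLinearGroup.coe_mul, Matrix.mul_apply,
    Fin.sum_univ_two] at hh ⊢
  rcases hh with ⟨hle, h0⟩ | ⟨hle, h0⟩
  · exact .inl (map_mul_add_lt_of_eq_neg_one ha hb hc hd h0 hle)
  · exact .inr (map_mul_add_lt_of_eq_neg_one ha hb hc hd h0.le hle)

lemma notMem_pingPongRegion {g : SL(2, K)} (h1 : g ∈ parahoricOneOf v)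
    (h2 : g ∈ parahoricTwoOf v) (i : Bool) : g ∉ pingPongRegion v i := by
  cases i
  · rintro (⟨-, h⟩ | ⟨-, h⟩)
    · exact h.not_ge h1.1
    · exact h.not_ge h1.2.1
  · rintro (⟨-, h⟩ | ⟨-, h⟩)
    · exact absurd (h2.2.2.1.trans h) (by norm_cast)
    · exact h.not_ge h1.2.2.2

variable {A₁ A₂ : Subgroup (SL(2, K))}

/-- Discreteness of an amalgam: the subgroup generated by `A₁ ≤ P₁` and `A₂ ≤ P₂` meets the
Iwahori subgroup in `A₁ ∩ A₂`, as soon as `A₁ ∩ P₂` and `A₂ ∩ P₁` are both contained there. -/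
lemma sup_inf_parahoric_le (h₁ : A₁ ≤ parahoricOneOf v) (h₂ : A₂ ≤ parahoricTwoOf v)
    (h₁₂ : A₁ ⊓ parahoricTwoOf v ≤ A₂) (h₂₁ : A₂ ⊓ parahoricOneOf v ≤ A₁) :
    (A₁ ⊔ A₂) ⊓ (parahoricOneOf v ⊓ parahoricTwoOf v) ≤ A₁ ⊓ A₂ := by
  rintro g ⟨hg, hg1, hg2⟩
  let A : Bool → Subgroup (SL(2, K)) := fun i ↦ if i then A₁ else A₂
  have key : ∀ i g, AlternatingProduct A i g → (∀ j, g ∈ A j) ∨ g ∈ pingPongRegion v (!i) := by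
    intro i g h
    induction h with
    | of_mem h => exact .inl h
    | @mul i a g ha ha' _ ih =>
      right
      cases i
      · simp only [A, Bool.not_false, if_true, Bool.not_true] at *
        have hn : a ∉ parahoricOneOf v := fun h ↦ ha' (h₂₁ ⟨ha, h⟩)
        rcases ih with ih | ih
        · refine mem_pingPongRegion_false (mul_mem (h₂ ha) (h₂ (ih false))) fun h ↦ hn ?_
          exact (Subgroup.mul_mem_cancel_right _ (h₁ (ih true))).1 h
        · exact mul_mem_pingPongRegion_false (h₂ ha) hn ih
      · simp only [A, Bool.not_false, if_true, Bool.not_true] at *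
        have hn : a ∉ parahoricTwoOf v := fun h ↦ ha' (h₁₂ ⟨ha, h⟩)
        rcases ih with ih | ih
        · refine mem_pingPongRegion_true (mul_mem (h₁ ha) (h₁ (ih true))) fun h ↦ hn ?_
          exact (Subgroup.mul_mem_cancel_right _ (h₂ (ih false))).1 h
        · exact mul_mem_pingPongRegion_true (h₁ ha) hn ih
  obtain ⟨i, hi⟩ := AlternatingProduct.exists_of_mem_sup (A := A) hg
  rcases key i g hi with h | h
  · exact ⟨h true, h false⟩
  · exact absurd h (notMem_pingPongRegion hg1 hg2 _)

/-- The upper unitriangular element of `SL₂` with upper right entry `x`. -/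
def upperUnipotent (x : K) : SL(2, K) := ⟨!![1, x; 0, 1], by simp⟩

/-- The standard Weyl element of `SL₂`. -/
def weylElement (K : Type*) [Field K] : SL(2, K) := ⟨!![0, 1; -1, 0], by simp⟩

/-- The diagonal element of `SL₂` with entries `x` and `x⁻¹`. -/
def diagElement (x : K) (hx : x ≠ 0) : SL(2, K) :=
  ⟨!![x, 0; 0, x⁻¹], by simp [hx]⟩

@[simp] lemma coe_upperUnipotent (x : K) :
    (upperUnipotent x : Matrix (Fin 2) (Fin 2) K) = !![1, x; 0, 1] := rfl

@[simp] lemma coe_weylElement :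
    (weylElement K : Matrix (Fin 2) (Fin 2) K) = !![0, 1; -1, 0] := rfl

@[simp] lemma coe_diagElement (x : K) (hx : x ≠ 0) :
    (diagElement x hx : Matrix (Fin 2) (Fin 2) K) = !![x, 0; 0, x⁻¹] := rfl

lemma diagElement_conj_upperUnipotent {x : K} (hx : x ≠ 0) (y : K) :
    diagElement x hx * upperUnipotent y * (diagElement x hx)⁻¹ = upperUnipotent (x ^ 2 * y) := by
  rw [mul_inv_eq_iff_eq_mul]
  ext i j
  fin_cases i <;> fin_cases j <;> simp [Matrix.mul_apply]
  field_simp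

/-- `SL₂` is generated by the upper unitriangular matrices and the Weyl element. -/
lemma eq_top_of_upperUnipotent_mem {S : Subgroup (SL(2, K))}
    (hU : ∀ x, upperUnipotent x ∈ S) (hw : weylElement K ∈ S) : S = ⊤ := by
  have key : ∀ g : SL(2, K), g 1 0 ≠ 0 → g ∈ S := by
    intro g hg
    have hdet := g.det_coe
    rw [Matrix.det_fin_two] at hdet
    have : g = upperUnipotent ((g 0 0 - 1) / g 1 0) *
        (weylElement K * upperUnipotent (-g 1 0) * (weylElement K)⁻¹) *
        upperUnipotent ((g 1 1 - 1) / g 1 0) := by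
      ext i j
      fin_cases i <;> fin_cases j <;>
        simp [Matrix.mul_apply, Matrix.adjugate_fin_two] <;> field_simp
      · ring
      · linear_combination -hdet
      · ring
    rw [this]
    exact mul_mem (mul_mem (hU _) (mul_mem (mul_mem hw (hU _)) (inv_mem hw))) (hU _)
  rw [eq_top_iff]
  rintro g -
  by_cases hg : g 1 0 = 0
  · refine (Subgroup.mul_mem_cancel_left _ hw).1 (key _ ?_)
    have hdet := g.det_coe
    rw [Matrix.det_fin_two, hg] at hdet
    simp only [Matrix.SpecialLinearGroup.coe_mul, Matrix.mul_apply, Fin.sum_univ_two,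
      coe_weylElement]
    simp
    rintro h
    simp [h] at hdet
  · exact key g hg

lemma parahoricOneOf_sup_parahoricTwoOf {u : K} (hu : v u = ((1 : ℤ) : WithTop ℤ)) :
    parahoricOneOf v ⊔ parahoricTwoOf v = ⊤ := by
  have hu0 : u ≠ 0 := by rintro rfl; simp at hu
  have hu' : v u⁻¹ = ((-1 : ℤ) : WithTop ℤ) := by
    have h : v u + v u⁻¹ = 0 := by rw [← AddValuation.map_mul, mul_inv_cancel₀ hu0]; simp
    rw [hu] at h
    generalize v u⁻¹ = t at *
    cases t with
    | top => simp at h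
    | coe t => norm_cast at *; omega
  have hw : weylElement K ∈ parahoricOneOf v ⊔ parahoricTwoOf v := by
    refine Subgroup.mem_sup_left ?_
    simp [mem_parahoricOneOf]
  refine eq_top_of_upperUnipotent_mem (fun x ↦ ?_) hw
  have hD : diagElement (-u⁻¹) (by simpa) ∈ parahoricOneOf v ⊔ parahoricTwoOf v := by
    have : diagElement (-u⁻¹) (by simpa) * (weylElement K)⁻¹ ∈ parahoricTwoOf v := by
      simp [mem_parahoricTwoOf, Matrix.mul_apply, Matrix.adjugate_fin_two, hu, hu']
    exact (Subgroup.mul_mem_cancel_right _ (inv_mem hw)).1 (Subgroup.mem_sup_right this)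
  have key : ∀ (n : ℕ) (y : K), ((-(2 * n) : ℤ) : WithTop ℤ) ≤ v y →
      upperUnipotent y ∈ parahoricOneOf v ⊔ parahoricTwoOf v := by
    intro n
    induction n with
    | zero =>
      intro y hy
      refine Subgroup.mem_sup_left ?_
      simpa [mem_parahoricOneOf] using hy
    | succ n ih =>
      intro y hy
      have : upperUnipotent y = diagElement (-u⁻¹) (by simpa) * upperUnipotent (u ^ 2 * y) *
          (diagElement (-u⁻¹) (by simpa))⁻¹ := by
        rw [diagElement_conj_upperUnipotent]
        congr 1
        field_simp
      rw [this]
      refine mul_mem (mul_mem hD (ih _ ?_)) (inv_mem hD)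
      rw [AddValuation.map_mul, AddValuation.map_pow, hu]
      generalize v y = t at *
      cases t with
      | top => simp
      | coe t => norm_cast at *; simp at *; omega
  obtain hx | ⟨t, ht⟩ : v x = ⊤ ∨ ∃ t : ℤ, v x = t := by
    cases v x with
    | top => simp
    | coe t => simp
  · exact key 0 x (by simp [hx])
  · refine key t.natAbs x ?_
    rw [ht]
    norm_cast
    omega

/-- If `P_i = A_i B`, then the group generated by `A₁` and `A₂` acts transitively on edges. -/
lemma exists_eq_mul_of_parahoric {u : K} (hu : v u = ((1 : ℤ) : WithTop ℤ))
    (h₁ : ∀ g ∈ parahoricOneOf v, ∃ x ∈ A₁, ∃ b ∈ parahoricOneOf v ⊓ parahoricTwoOf v, g = x * b)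
    (h₂ : ∀ g ∈ parahoricTwoOf v, ∃ x ∈ A₂, ∃ b ∈ parahoricOneOf v ⊓ parahoricTwoOf v, g = x * b)
    (g : SL(2, K)) :
    ∃ b ∈ parahoricOneOf v ⊓ parahoricTwoOf v, ∃ c ∈ A₁ ⊔ A₂, g = b * c := by
  have hg : g ∈ parahoricOneOf v ⊔ parahoricTwoOf v := by
    rw [parahoricOneOf_sup_parahoricTwoOf hu]; trivial
  have step : ∀ x, x ∈ (parahoricOneOf v : Set (SL(2, K))) ∪
      parahoricTwoOf v → ∀ y, (∃ b ∈ parahoricOneOf v ⊓ parahoricTwoOf v, ∃ c ∈ A₁ ⊔ A₂,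
        y = b * c) → ∃ b ∈ parahoricOneOf v ⊓ parahoricTwoOf v, ∃ c ∈ A₁ ⊔ A₂, x * y = b * c := by
    rintro x hx _ ⟨b, hb, c, hc, rfl⟩
    obtain ⟨a, ha, b', hb', h⟩ : ∃ a ∈ A₁ ⊔ A₂, ∃ b' ∈ parahoricOneOf v ⊓ parahoricTwoOf v,
        (x * b)⁻¹ = a * b' := by
      rcases hx with hx | hx
      · obtain ⟨a, ha, h⟩ := h₁ (x * b)⁻¹ (inv_mem (mul_mem hx hb.1))
        exact ⟨a, Subgroup.mem_sup_left ha, h⟩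
      · obtain ⟨a, ha, h⟩ := h₂ (x * b)⁻¹ (inv_mem (mul_mem hx hb.2))
        exact ⟨a, Subgroup.mem_sup_right ha, h⟩
    refine ⟨b'⁻¹, inv_mem hb', a⁻¹ * c, mul_mem (inv_mem ha) hc, ?_⟩
    rw [← mul_assoc, ← mul_assoc, ← mul_inv_rev, ← h, inv_inv]
  rw [Subgroup.sup_eq_closure] at hg
  induction hg using Subgroup.closure_induction_left with
  | one => exact ⟨1, one_mem _, 1, one_mem _, by simp⟩
  | mul_left x hx y _ ih => exact step x hx y ih
  | inv_mul_cancel x hx y _ ih =>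
    refine step x⁻¹ ?_ y ih
    rcases hx with hx | hx
    · exact .inl (inv_mem hx)
    · exact .inr (inv_mem hx)

/-- Elements of order dividing the characteristic are conjugate to unitriangular ones. -/
lemma exists_conj_eq_upperUnipotent (p : ℕ) [Fact p.Prime] [CharP K p]
    {g : SL(2, K)} (hg : g ^ p = 1) :
    ∃ h x, h * g * h⁻¹ = upperUnipotent x := by
  have hnil : ((g : Matrix (Fin 2) (Fin 2) K) - 1) ^ 2 = 0 := by
    have h0 : IsNilpotent ((g : Matrix (Fin 2) (Fin 2) K) - 1) := by
      refine ⟨p, ?_⟩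
      rw [sub_pow_char_of_commute (p := p) (Commute.one_right _), ← Matrix.SpecialLinearGroup.coe_pow, hg]
      simp
    have := Matrix.isNilpotent_charpoly_sub_pow_of_isNilpotent h0
    have h2 := Matrix.aeval_self_charpoly ((g : Matrix (Fin 2) (Fin 2) K) - 1)
    rw [sub_eq_zero.1 this.eq_zero] at h2
    simpa using h2
  have hdet := g.det_coe
  rw [Matrix.det_fin_two] at hdet
  have e00 := congr_fun₂ hnil 0 0
  have e01 := congr_fun₂ hnil 0 1
  have e10 := congr_fun₂ hnil 1 0
  have e11 := congr_fun₂ hnil 1 1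
  simp [pow_two, Matrix.mul_apply] at e00 e01 e10 e11
  by_cases hc : g 1 0 = 0
  · refine ⟨1, g 0 1, ?_⟩
    simp [hc] at e00 e11
    ext i j
    fin_cases i <;> fin_cases j <;> simp [hc] <;> grind
  · refine ⟨weylElement K * upperUnipotent (-(g 0 0 - 1) / g 1 0), -g 1 0, ?_⟩
    rw [mul_inv_eq_iff_eq_mul]
    have h1 : g 1 1 = 2 - g 0 0 := by
      have : g 1 0 * (g 0 0 + g 1 1 - 2) = 0 := by linear_combination e10
      have := (mul_eq_zero.1 this).resolve_left hc
      linear_combination this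
    have h2 : g 0 1 = -(g 0 0 - 1) ^ 2 / g 1 0 := by field_simp; linear_combination e00
    ext i j
    fin_cases i <;> fin_cases j <;> simp [Matrix.mul_apply, h1, h2] <;> field_simp <;> ring

/-- An edge-transitive lattice in `SL₂` over a local field of characteristic `p` has no elements
of order `p`. -/
theorem eq_one_of_pow_char_eq_one (p : ℕ) [Fact p.Prime] [CharP K p] {u : K}
    (hu : v u = ((1 : ℤ) : WithTop ℤ)) [Finite A₁]
    (hA₁ : A₁ ≤ parahoricOneOf v) (hA₂ : A₂ ≤ parahoricTwoOf v)
    (h₁₂ : A₁ ⊓ parahoricTwoOf v ≤ A₂) (h₂₁ : A₂ ⊓ parahoricOneOf v ≤ A₁)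
    (h₁ : ∀ g ∈ parahoricOneOf v, ∃ x ∈ A₁, ∃ b ∈ parahoricOneOf v ⊓ parahoricTwoOf v, g = x * b)
    (h₂ : ∀ g ∈ parahoricTwoOf v, ∃ x ∈ A₂, ∃ b ∈ parahoricOneOf v ⊓ parahoricTwoOf v, g = x * b)
    {g : SL(2, K)} (hgA : g ∈ A₁) (hg : g ^ p = 1) : g = 1 := by
  have hu0 : u ≠ 0 := by rintro rfl; simp at hu
  obtain ⟨M, hM⟩ : ∃ M : ℤ, ∀ a ∈ A₁, (∀ i j, (M : WithTop ℤ) ≤ v (a i j - (1 : Matrix _ _ K) i j)) →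
      a = 1 := by
    have : ∀ a : A₁, ∃ M : ℤ, ∀ N : ℤ, M ≤ N →
        (∀ i j, (N : WithTop ℤ) ≤ v ((a : SL(2, K)) i j - (1 : Matrix _ _ K) i j))
          → a = 1 := by
      intro a
      by_cases ha : a = 1
      · exact ⟨0, by simp [ha]⟩
      · obtain ⟨i, j, hij⟩ : ∃ i j, (a : SL(2, K)) i j ≠
            (1 : Matrix (Fin 2) (Fin 2) K) i j := by
          by_contra! h
          exact ha (Subtype.ext (Matrix.SpecialLinearGroup.ext _ _ h))
        have ht : v ((a : SL(2, K)) i j - (1 : Matrix _ _ K) i j) ≠ ⊤ := by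
          rw [ne_eq, AddValuation.top_iff, sub_eq_zero]
          exact hij
        obtain ⟨t, ht⟩ := WithTop.ne_top_iff_exists.1 ht
        refine ⟨t + 1, fun N hN h ↦ ?_⟩
        have := h i j
        rw [← ht] at this
        norm_cast at this
        omega
    choose M hM using this
    obtain ⟨N, hN⟩ := (Set.finite_range M).bddAbove
    exact ⟨N, fun a ha h ↦ congrArg Subtype.val (hM ⟨a, ha⟩ N (hN ⟨_, rfl⟩) h)⟩
  obtain ⟨h, x, hx⟩ := exists_conj_eq_upperUnipotent p hg
  have hconj : ∀ n : ℕ, ∃ k, k * g * k⁻¹ = upperUnipotent (u ^ (2 * n) * x) := by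
    intro n
    refine ⟨diagElement (u ^ n) (pow_ne_zero _ hu0) * h, ?_⟩
    rw [mul_comm 2 n, pow_mul, ← diagElement_conj_upperUnipotent (pow_ne_zero n hu0), ← hx]
    group
  have exists_le : ∀ M : ℤ, ∃ n : ℕ, (M : WithTop ℤ) ≤ v (u ^ (2 * n) * x) := by
    intro M
    by_cases hx0 : v x = ⊤
    · exact ⟨0, by simp [hx0]⟩
    · obtain ⟨t, ht⟩ := WithTop.ne_top_iff_exists.1 hx0
      refine ⟨(M - t).toNat, ?_⟩
      rw [AddValuation.map_mul, AddValuation.map_pow, hu, ← ht, ← WithTop.coe_nsmul,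
        ← WithTop.coe_add, WithTop.coe_le_coe, nsmul_eq_mul]
      push_cast
      have := Int.self_le_toNat (M - t)
      omega
  obtain ⟨n, hn'⟩ := exists_le (max M 0)
  have hn : (M : WithTop ℤ) ≤ v (u ^ (2 * n) * x) :=
    (WithTop.coe_le_coe.2 (le_max_left _ _)).trans hn'
  have hn0 : 0 ≤ v (u ^ (2 * n) * x) :=
    (WithTop.coe_le_coe.2 (le_max_right M 0)).trans hn'
  obtain ⟨k, hk⟩ := hconj n
  obtain ⟨b, hb, c, hc, rfl⟩ := exists_eq_mul_of_parahoric hu h₁ h₂ k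
  set y := u ^ (2 * n) * x
  have hcg : c * g * c⁻¹ = b⁻¹ * upperUnipotent y * b := by rw [← hk]; group
  have hent : ∀ i j, (M : WithTop ℤ) ≤ v ((c * g * c⁻¹) i j - (1 : Matrix _ _ K) i j) := by
    rw [hcg]
    have hdet := b.det_coe
    rw [Matrix.det_fin_two] at hdet
    have h00 : (b⁻¹ * upperUnipotent y * b) 0 0 - (1 : Matrix _ _ K) 0 0 = b 1 1 * b 1 0 * y := by
      simp [Matrix.mul_apply, Matrix.adjugate_fin_two]
      linear_combination hdet
    have h01 : (b⁻¹ * upperUnipotent y * b) 0 1 - (1 : Matrix _ _ K) 0 1 = b 1 1 * b 1 1 * y := by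
      simp [Matrix.mul_apply, Matrix.adjugate_fin_two]
      ring
    have h10 : (b⁻¹ * upperUnipotent y * b) 1 0 - (1 : Matrix _ _ K) 1 0 =
        -(b 1 0 * b 1 0 * y) := by
      simp [Matrix.mul_apply, Matrix.adjugate_fin_two]
      ring
    have h11 : (b⁻¹ * upperUnipotent y * b) 1 1 - (1 : Matrix _ _ K) 1 1 =
        -(b 1 0 * b 1 1 * y) := by
      simp [Matrix.mul_apply, Matrix.adjugate_fin_two]
      linear_combination hdet
    obtain ⟨⟨-, -, hb10, hb11⟩, -⟩ := hb
    have : ∀ s t : K, 0 ≤ v s → 0 ≤ v t → (M : WithTop ℤ) ≤ v (s * t * y) := by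
      intro s t hs ht
      rw [AddValuation.map_mul, AddValuation.map_mul]
      exact hn.trans (le_add_of_nonneg_left (add_nonneg hs ht))
    intro i j
    fin_cases i <;> fin_cases j
    · exact (this _ _ hb11 hb10).trans_eq (congrArg v h00.symm)
    · exact (this _ _ hb11 hb11).trans_eq (congrArg v h01.symm)
    · exact ((this _ _ hb10 hb10).trans_eq (v.map_neg _).symm).trans_eq (congrArg v h10.symm)
    · exact ((this _ _ hb10 hb11).trans_eq (v.map_neg _).symm).trans_eq (congrArg v h11.symm)
  have hmem : c * g * c⁻¹ ∈ A₁ := by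
    refine (sup_inf_parahoric_le hA₁ hA₂ h₁₂ h₂₁ (Subgroup.mem_inf.2 ⟨?_, ?_⟩)).1
    · exact mul_mem (mul_mem hc (Subgroup.mem_sup_left hgA)) (inv_mem hc)
    · have hU : upperUnipotent y ∈ parahoricOneOf v ⊓ parahoricTwoOf v := by
        refine ⟨?_, ?_⟩
        · simpa [mem_parahoricOneOf] using hn0
        · simpa [mem_parahoricTwoOf] using le_trans (by norm_cast) hn0
      rw [hcg]
      exact mul_mem (mul_mem (inv_mem hb) hU) hb
  have := hM _ hmem hent
  simpa using this

end Parahoric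

section FixedPoints

lemma eq_six_or_thirty_of_add_eq {Q c d k r s : ℕ} (hQ : 3 ≤ Q) (hk : Even k) (hr : Odd r)
    (hs : Odd s) (hr1 : r ≠ 1) (hs1 : s ≠ 1) (h₁ : k * Q = r * c) (h₂ : k * Q = s * d)
    (h : Q + c + d = k * Q + 2) : Q = 6 ∨ Q = 30 := by
  have hr3 : 3 ≤ r := by obtain ⟨t, rfl⟩ := hr; omega
  have hs3 : 3 ≤ s := by obtain ⟨t, rfl⟩ := hs; omega
  have hc : 3 * c ≤ k * Q := h₁ ▸ Nat.mul_le_mul_right c hr3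
  have hd : 3 * d ≤ k * Q := h₂ ▸ Nat.mul_le_mul_right d hs3
  have hk4 : k < 4 := by
    by_contra! hk
    have := Nat.mul_le_mul_right Q hk
    omega
  obtain rfl : k = 2 := by
    obtain ⟨t, rfl⟩ := hk
    have : t ≠ 0 := by rintro rfl; omega
    omega
  have hr5 : r = 3 ∨ 5 ≤ r := by obtain ⟨t, rfl⟩ := hr; omega
  have hs5 : s = 3 ∨ 5 ≤ s := by obtain ⟨t, rfl⟩ := hs; omega
  have aux : ∀ {c d s : ℕ}, Odd s → 3 ≤ s → 2 * Q = 3 * c → 2 * Q = s * d →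
      Q + c + d = 2 * Q + 2 → Q = 6 ∨ Q = 30 := by
    intro c d s hs hs3 h₁ h₂ h
    have hs6 : s < 6 := by
      by_contra! hs
      have := Nat.mul_le_mul_right d hs
      omega
    obtain ⟨t, rfl⟩ := hs
    obtain rfl | rfl : t = 1 ∨ t = 2 := by omega
    all_goals omega
  rcases hr5 with rfl | hr5
  · exact aux hs hs3 h₁ h₂ h
  · rcases hs5 with rfl | hs5
    · exact aux hr hr3 h₂ h₁ (by omega)
    · have := Nat.mul_le_mul_right c hr5
      have := Nat.mul_le_mul_right d hs5
      omega

variable {H X : Type*} [Group H] [MulAction H X]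

open MulAction

/-- The set of points fixed by some element outside of the normal subgroup `Z`. -/
def fixedByNotMem (X : Type*) [MulAction H X] (Z : Subgroup H) [Z.Normal] : SubMulAction H X where
  carrier := {x | ∃ h ∉ Z, h • x = x}
  smul_mem' := by
    rintro k x ⟨h, hh, hx⟩
    refine ⟨k * h * k⁻¹, fun h' ↦ hh ?_, by simp [mul_smul, hx]⟩
    simpa [mul_assoc] using Subgroup.Normal.conj_mem ‹_› _ h' k⁻¹

/-- Orbit counting for a finite group all of whose elements outside of a central subgroup of order
two acting trivially have exactly two fixed points. -/
lemma sum_card_orbit_eq [Finite H] (Z : Subgroup H) [Z.Normal] (hZ : Nat.card Z = 2)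
    (hZX : ∀ z ∈ Z, ∀ x : X, z • x = x) (hfix : ∀ h ∉ Z, (fixedBy X h).ncard = 2) :
    Finite (fixedByNotMem X Z) ∧
    2 * Nat.card (fixedByNotMem X Z) + 2 * Nat.card H =
      Nat.card (orbitRel.Quotient H (fixedByNotMem X Z)) * Nat.card H + 4 := by
  classical
  have hfin : Finite (fixedByNotMem X Z) := by
    have : (⋃ h : {h // h ∉ Z}, fixedBy X h.1).Finite :=
      Set.finite_iUnion fun h ↦ Set.finite_of_ncard_ne_zero (by rw [hfix _ h.2]; simp)
    refine (this.subset ?_).to_subtype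
    rintro x ⟨h, hh, hx⟩
    exact Set.mem_iUnion.2 ⟨⟨h, hh⟩, hx⟩
  refine ⟨hfin, ?_⟩
  have := Fintype.ofFinite H
  have := Fintype.ofFinite (fixedByNotMem X Z)
  have := Fintype.ofFinite (orbitRel.Quotient H (fixedByNotMem X Z))
  have burnside := sum_card_fixedBy_eq_card_orbits_mul_card_group H (fixedByNotMem X Z)
  have hval : ∀ h : H, Fintype.card (fixedBy (fixedByNotMem X Z) h) =
      if h ∈ Z then Nat.card (fixedByNotMem X Z) else 2 := by
    intro h
    rw [Fintype.card_eq_nat_card]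
    split_ifs with hh
    · have : fixedBy (fixedByNotMem X Z) h = Set.univ := by
        ext x
        simpa [Subtype.ext_iff] using hZX h hh x
      rw [this, Nat.card_univ]
    · rw [← hfix h hh, ← Nat.card_coe_set_eq]
      exact Nat.card_congr
        { toFun x := ⟨x.1.1, congrArg Subtype.val x.2⟩
          invFun x := ⟨⟨x.1, h, hh, x.2⟩, Subtype.ext x.2⟩ }
  simp_rw [hval] at burnside
  rw [Finset.sum_ite, Finset.sum_const, Finset.sum_const] at burnside
  have hc1 : (Finset.univ.filter (· ∈ Z)).card = 2 := by
    rw [← hZ, Nat.card_eq_fintype_card, Fintype.card_subtype]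
  have hc2 := Finset.card_filter_add_card_filter_not (s := (Finset.univ : Finset H)) (· ∈ Z)
  rw [hc1] at burnside hc2
  rw [Finset.card_univ] at hc2
  simp only [Nat.card_eq_fintype_card, smul_eq_mul] at *
  rw [← burnside]
  omega

theorem ncard_orbit_eq_six_or_thirty [Finite H] (Z : Subgroup H) [Z.Normal] (hZ : Nat.card Z = 2)
    (hZX : ∀ z ∈ Z, ∀ x : X, z • x = x) (hfix : ∀ h ∉ Z, (fixedBy X h).ncard = 2) (x₀ : X)
    (hQ : 3 ≤ (orbit H x₀).ncard) (h4 : 4 ∣ Nat.card (stabilizer H x₀))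
    (hx : ∀ x ∉ orbit H x₀, ¬ 4 ∣ Nat.card (stabilizer H x)) :
    (orbit H x₀).ncard = 6 ∨ (orbit H x₀).ncard = 30 := by
  classical
  obtain ⟨hfin, hcount⟩ := sum_card_orbit_eq Z hZ hZX hfix
  set V := fixedByNotMem X Z with hV
  have := Fintype.ofFinite H
  have := Fintype.ofFinite V
  have := Fintype.ofFinite (orbitRel.Quotient H V)
  have hle : ∀ x : X, Z ≤ stabilizer H x := fun x z hz ↦ hZX z hz x
  have hsub : ∀ x : X, ∃ r, Nat.card (stabilizer H x) = 2 * r ∧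
      Nat.card H = 2 * (r * (orbit H x).ncard) := by
    intro x
    obtain ⟨r, hr⟩ := hZ ▸ Subgroup.card_dvd_of_le (hle x)
    refine ⟨r, hr, ?_⟩
    rw [← mul_assoc, ← hr, mul_comm, ← Nat.card_coe_set_eq,
      ← Nat.card_congr (orbitProdStabilizerEquivGroup H x), Nat.card_prod]
  have hx₀V : x₀ ∈ V := by
    by_contra h
    have : stabilizer H x₀ ≤ Z := fun g hg ↦ by
      by_contra hgZ
      exact h ⟨g, hgZ, hg⟩
    have := Nat.le_of_dvd (by rw [hZ]; exact two_pos) (h4.trans (Subgroup.card_dvd_of_le this))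
    omega
  have horb : ∀ x : V, Nat.card (orbit H x) = (orbit H (x : X)).ncard := by
    intro x
    rw [← SubMulAction.val_image_orbit, Set.ncard_image_of_injective _ Subtype.val_injective,
      Nat.card_coe_set_eq]
  have hsum : Nat.card V = ∑ ω : orbitRel.Quotient H V, Nat.card ω.orbit := by
    rw [Nat.card_congr (selfEquivSigmaOrbits' H V), Nat.card_sigma]
  obtain ⟨k, hk, hN⟩ := hsub x₀
  have hk2 : Even k := by
    rw [hk] at h4
    exact even_iff_two_dvd.2 (by omega)
  let ω₀ : orbitRel.Quotient H V := Quotient.mk'' ⟨x₀, hx₀V⟩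
  have hω₀ : Nat.card ω₀.orbit = (orbit H x₀).ncard := horb ⟨x₀, hx₀V⟩
  have hω : ∀ ω ∈ Finset.univ.erase ω₀, ∃ r, Odd r ∧ r ≠ 1 ∧
      k * (orbit H x₀).ncard = r * Nat.card ω.orbit := by
    intro ω hω
    induction ω using Quotient.inductionOn' with | _ x
    obtain ⟨x, hxV⟩ := x
    obtain ⟨r, hr, hNr⟩ := hsub x
    refine ⟨r, ?_, ?_, ?_⟩
    · have hxo : x ∉ orbit H x₀ := by
        rintro ⟨h, hh⟩
        refine Finset.ne_of_mem_erase hω (Quotient.sound' ⟨h, Subtype.ext hh⟩)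
      have := hx x hxo
      rw [← Nat.not_even_iff_odd, even_iff_two_dvd]
      omega
    · rintro rfl
      obtain ⟨h, hh, hhx⟩ := hxV
      have : Z = stabilizer H x := Subgroup.eq_of_le_of_card_ge (hle x) (by rw [hZ, hr])
      rw [this] at hh
      exact hh hhx
    · rw [orbitRel.Quotient.orbit_mk, horb]
      exact Nat.eq_of_mul_eq_mul_left two_pos (hN.symm.trans hNr)
  have hQk : 2 * (orbit H x₀).ncard ≤ k * (orbit H x₀).ncard := by
    refine Nat.mul_le_mul_right _ ?_
    have : k ≠ 0 := by
      rintro rfl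
      simp at hN
    obtain ⟨t, rfl⟩ := hk2
    omega
  have hcardΩ : Nat.card (orbitRel.Quotient H V) = (Finset.univ.erase ω₀).card + 1 := by
    rw [Finset.card_erase_add_one (Finset.mem_univ _), Finset.card_univ, Nat.card_eq_fintype_card]
  rw [← Finset.add_sum_erase _ _ (Finset.mem_univ ω₀), hω₀] at hsum
  rw [hsum, hcardΩ, hN] at hcount
  generalize Finset.univ.erase ω₀ = S at *
  set Q := (orbit H x₀).ncard
  have hbound : 3 * ∑ ω ∈ S, Nat.card ω.orbit ≤ S.card * (k * Q) := by
    rw [Finset.mul_sum, ← smul_eq_mul S.card]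
    refine Finset.sum_le_card_nsmul _ _ _ fun ω h ↦ ?_
    obtain ⟨r, hr, hr1, hrω⟩ := hω ω h
    rw [hrω]
    refine Nat.mul_le_mul_right _ ?_
    obtain ⟨t, rfl⟩ := hr
    omega
  have hcard : S.card < 3 := by
    by_contra! h
    have := Nat.mul_le_mul_right (k * Q) h
    have : (S.card + 1) * (2 * (k * Q)) = 2 * (S.card * (k * Q)) + 2 * (k * Q) := by ring
    omega
  obtain h | h | h : S.card = 0 ∨ S.card = 1 ∨ S.card = 2 := by omega
  · rw [Finset.card_eq_zero] at h
    simp [h] at hcount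
    omega
  · rw [h] at hcount
    omega
  · obtain ⟨ω₁, ω₂, hne, rfl⟩ := Finset.card_eq_two.1 h
    obtain ⟨r, hr, hr1, hrω⟩ := hω ω₁ (by simp)
    obtain ⟨s, hs, hs1, hsω⟩ := hω ω₂ (by simp)
    rw [Finset.sum_pair hne, h] at hcount
    exact eq_six_or_thirty_of_add_eq hQ hk2 hr hs hr1 hs1 hrω hsω (by omega)

end FixedPoints
section SpecialLinear

open MulAction

variable {F : Type*} [Field F]

lemma det_eq_one_fin_two (g : SL(2, F)) : g 0 0 * g 1 1 - g 0 1 * g 1 0 = 1 := by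
  rw [← Matrix.det_fin_two, g.det_coe]

lemma eq_one_or_eq_neg_one_of_mul_self (h2 : (2 : F) ≠ 0) {g : SL(2, F)} (hg : g * g = 1) :
    g = 1 ∨ g = -1 := by
  have hinv : g = g⁻¹ := eq_inv_of_mul_eq_one_left hg
  have hdet := det_eq_one_fin_two g
  have h : (g : Matrix (Fin 2) (Fin 2) F) = ((g⁻¹ : SL(2, F)) : Matrix (Fin 2) (Fin 2) F) :=
    congrArg _ hinv
  rw [Matrix.SpecialLinearGroup.coe_inv, Matrix.adjugate_fin_two] at h
  have h00 : g 0 0 = g 1 1 := by simpa using congr_fun₂ h 0 0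
  have h01 : g 0 1 = -g 0 1 := by simpa using congr_fun₂ h 0 1
  have h10 : g 1 0 = -g 1 0 := by simpa using congr_fun₂ h 1 0
  have h01 : g 0 1 = 0 := by
    have : 2 * g 0 1 = 0 := by linear_combination h01
    exact (mul_eq_zero.1 this).resolve_left h2
  have h10 : g 1 0 = 0 := by
    have : 2 * g 1 0 = 0 := by linear_combination h10
    exact (mul_eq_zero.1 this).resolve_left h2
  have : g 1 1 * g 1 1 = 1 := by rw [h00, h01] at hdet; simpa using hdet
  rcases mul_self_eq_one_iff.1 this with h | h
  · left
    ext i j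
    fin_cases i <;> fin_cases j <;> simp [h00, h01, h10, h]
  · right
    ext i j
    fin_cases i <;> fin_cases j <;> simp [h00, h01, h10, h]

lemma eq_one_of_trace_eq_two (p : ℕ) [Fact p.Prime] [CharP F p] {g : SL(2, F)} {n : ℕ}
    (hn : ¬ p ∣ n) (hg : g ^ n = 1) (htr : g 0 0 + g 1 1 = 2) : g = 1 := by
  have hdet := det_eq_one_fin_two g
  have hsq : ((g : Matrix (Fin 2) (Fin 2) F) - 1) ^ 2 = 0 := by
    have hd : g 1 1 = 2 - g 0 0 := by linear_combination htr
    rw [hd] at hdet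
    ext i j
    fin_cases i <;> fin_cases j <;> simp [pow_two, Matrix.mul_apply, hd]
    · linear_combination -hdet
    · ring
    · ring
    · linear_combination -hdet
  have hp : (g : Matrix (Fin 2) (Fin 2) F) ^ p = 1 := by
    have := sub_pow_char_of_commute (p := p) (Commute.one_right (g : Matrix (Fin 2) (Fin 2) F))
    rw [pow_eq_zero_of_le (Nat.Prime.two_le Fact.out) hsq, one_pow] at this
    exact (sub_eq_zero.1 this.symm)
  have hp : g ^ p = 1 := by
    ext1
    simpa using congr_fun₂ hp _ _
  rw [← pow_one g, ← (Nat.Prime.coprime_iff_not_dvd Fact.out).2 hn]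
  exact pow_gcd_eq_one.2 ⟨hp, hg⟩

lemma eq_one_or_eq_neg_one_of_trace_sq (p : ℕ) [Fact p.Prime] [CharP F p] (h2 : (2 : F) ≠ 0)
    {g : SL(2, F)} {n : ℕ} (hn : ¬ p ∣ n) (hg : g ^ n = 1) (htr : (g 0 0 + g 1 1) ^ 2 = 4) :
    g = 1 ∨ g = -1 := by
  have : (g 0 0 + g 1 1 - 2) * (g 0 0 + g 1 1 + 2) = 0 := by linear_combination htr
  rcases mul_eq_zero.1 this with h | h
  · exact .inl (eq_one_of_trace_eq_two p hn hg (by linear_combination h))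
  · right
    rw [← neg_eq_iff_eq_neg]
    refine eq_one_of_trace_eq_two p (n := 2 * n) ?_ ?_ ?_
    · rw [Nat.Prime.dvd_mul Fact.out, not_or]
      refine ⟨fun h ↦ h2 ?_, hn⟩
      exact_mod_cast (CharP.cast_eq_zero_iff F p 2).2 h
    · rw [pow_mul, neg_sq, ← pow_mul, mul_comm, pow_mul, hg, one_pow]
    · simp
      linear_combination -h

lemma trace_eq_zero_of_mul_self {g : SL(2, F)} (hg : g * g = -1) : g 1 1 = -g 0 0 := by
  have hdet := det_eq_one_fin_two g
  have h : (g : Matrix (Fin 2) (Fin 2) F) * g = -1 := by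
    rw [← Matrix.SpecialLinearGroup.coe_mul, hg]
    simp
  have h00 := congr_fun₂ h 0 0
  have h01 := congr_fun₂ h 0 1
  have h10 := congr_fun₂ h 1 0
  simp [Matrix.mul_apply] at h00 h01 h10
  by_contra hne
  have hne : g 0 0 + g 1 1 ≠ 0 := fun h ↦ hne (by linear_combination h)
  have hb : g 0 1 = 0 := mul_right_cancel₀ hne (by linear_combination h01)
  have ha : g 0 0 = 0 := mul_right_cancel₀ hne (by linear_combination h00 + hdet)
  simp [ha, hb] at h00

lemma exists_mul_self_eq_neg_one (h2 : (2 : F) ≠ 0) (S : Subgroup SL(2, F)) [Finite S]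
    (hS : 4 ∣ Nat.card S) : ∃ g ∈ S, g * g = -1 := by
  obtain ⟨T, hT⟩ := Sylow.exists_subgroup_card_pow_prime (G := S) 2 (n := 2) (by simpa using hS)
  by_contra! hne
  have hT' : ∀ t : T, (t : SL(2, F)) = 1 ∨ (t : SL(2, F)) = -1 := by
    intro t
    have h4 : (t : SL(2, F)) ^ 4 = 1 := by
      have : t ^ 4 = 1 := by
        have := pow_card_eq_one' (x := t)
        rwa [hT] at this
      simpa [Subtype.ext_iff] using this
    have : ((t : SL(2, F)) * t) * (t * t) = 1 := by rw [← h4]; simp [pow_succ, mul_assoc]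
    rcases eq_one_or_eq_neg_one_of_mul_self h2 this with h | h
    · exact eq_one_or_eq_neg_one_of_mul_self h2 h
    · exact absurd h (hne _ t.1.2)
  have : Nat.card T ≤ Nat.card ({1, -1} : Set SL(2, F)) :=
    Nat.card_le_card_of_injective (fun t ↦ ⟨(t : SL(2, F)), hT' t⟩) fun s t h ↦ by
      have := Subtype.ext_iff.1 h
      exact Subtype.ext (Subtype.ext this)
  rw [hT, Nat.card_coe_set_eq] at this
  have := this.trans (Set.ncard_insert_le _ _)
  simp at this

open scoped Classical in
/-- The action of `SL₂(F)` by Möbius transformations on the projective line over an extension. -/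
noncomputable abbrev mobiusAction (F L : Type*) [Field F] [Field L] [Algebra F L] :
    MulAction SL(2, F) (OnePoint L) :=
  MulAction.compHom _ (Matrix.SpecialLinearGroup.toGL.comp
    (Matrix.SpecialLinearGroup.map (algebraMap F L)))

attribute [local instance] mobiusAction

variable {L : Type*} [Field L] [Algebra F L]

open OnePoint

lemma mobius_smul_infty_eq_self_iff {g : SL(2, F)} : g • (∞ : OnePoint L) = ∞ ↔ g 1 0 = 0 := by
  classical
  refine OnePoint.smul_infty_eq_self_iff.trans ?_
  exact map_eq_zero_iff _ (algebraMap F L).injective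

lemma mobius_smul_infty_of_ne {g : SL(2, F)} (hg : g 1 0 ≠ 0) :
    g • (∞ : OnePoint L) = (algebraMap F L (g 0 0 / g 1 0) : L) := by
  classical
  refine (OnePoint.smul_infty_eq_ite _).trans ?_
  rw [if_neg, map_div₀]
  · rfl
  · exact fun h ↦ hg ((map_eq_zero_iff _ (algebraMap F L).injective).1 h)

lemma mobius_smul_coe_eq_self_iff {g : SL(2, F)} {x : L} :
    g • (x : OnePoint L) = x ↔ algebraMap F L (g 1 0) * (x * x) +
      algebraMap F L (g 1 1 - g 0 0) * x + algebraMap F L (-g 0 1) = 0 := by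
  classical
  refine Matrix.GeneralLinearGroup.fixpointPolynomial_aeval_eq_zero_iff.symm.trans ?_
  rw [map_sub, map_neg, ← sub_eq_add_neg, ← pow_two]
  simp [Matrix.GeneralLinearGroup.fixpointPolynomial]

lemma neg_one_mobius_smul (x : OnePoint L) : (-1 : SL(2, F)) • x = x := by
  cases x with
  | infty => simp [mobius_smul_infty_eq_self_iff]
  | coe x => simp [mobius_smul_coe_eq_self_iff]

lemma ncard_fixedBy_mobius [IsAlgClosed L] (h2 : (2 : F) ≠ 0) {g : SL(2, F)}
    (hg : (g 0 0 + g 1 1) ^ 2 ≠ 4) : (fixedBy (OnePoint L) g).ncard = 2 := by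
  have hdet := det_eq_one_fin_two g
  have h2' : (2 : L) ≠ 0 := by
    have := (map_ne_zero_iff _ (algebraMap F L).injective).2 h2
    rwa [map_ofNat] at this
  have : NeZero (2 : L) := ⟨h2'⟩
  by_cases hc : g 1 0 = 0
  · have hne : g 1 1 - g 0 0 ≠ 0 := by
      intro h
      apply hg
      rw [hc] at hdet
      linear_combination 4 * hdet + (g 1 1 - g 0 0) * h
    have : fixedBy (OnePoint L) g =
        {∞, ((algebraMap F L (g 0 1 / (g 1 1 - g 0 0)) : L) : OnePoint L)} := by
      ext x
      cases x with
      | infty => simp [mobius_smul_infty_eq_self_iff, hc]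
      | coe x =>
        have hne' := (map_ne_zero_iff _ (algebraMap F L).injective).2 hne
        rw [mem_fixedBy, mobius_smul_coe_eq_self_iff, hc]
        simp only [Set.mem_insert_iff, Set.mem_singleton_iff, coe_ne_infty, false_or, coe_eq_coe]
        rw [map_div₀, eq_div_iff hne', map_neg, map_zero]
        constructor <;> intro h <;> linear_combination h
    rw [this, Set.ncard_pair (infty_ne_coe _)]
  · have hc' := (map_ne_zero_iff _ (algebraMap F L).injective).2 hc
    obtain ⟨s, hs⟩ := IsAlgClosed.exists_eq_mul_self (discrim (algebraMap F L (g 1 0))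
      (algebraMap F L (g 1 1 - g 0 0)) (algebraMap F L (-g 0 1)))
    have hs0 : s ≠ 0 := by
      rintro rfl
      rw [discrim, mul_zero, ← map_pow, ← map_ofNat (algebraMap F L) 4, ← map_mul, ← map_mul,
        ← map_sub, map_eq_zero_iff _ (algebraMap F L).injective] at hs
      apply hg
      linear_combination hs + 4 * hdet
    have : fixedBy (OnePoint L) g =
        {((((-algebraMap F L (g 1 1 - g 0 0) + s) / (2 * algebraMap F L (g 1 0))) : L) : OnePoint L),
          (((-algebraMap F L (g 1 1 - g 0 0) - s) / (2 * algebraMap F L (g 1 0)) : L) :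
            OnePoint L)} := by
      ext x
      cases x with
      | infty => simp [mobius_smul_infty_eq_self_iff, hc]
      | coe x =>
        rw [mem_fixedBy, mobius_smul_coe_eq_self_iff, quadratic_eq_zero_iff hc' hs]
        simp only [Set.mem_insert_iff, Set.mem_singleton_iff, coe_eq_coe]
    rw [this, Set.ncard_pair]
    rw [ne_eq, coe_eq_coe, div_left_inj' (mul_ne_zero h2' hc')]
    intro h
    have : 2 * s = 0 := by linear_combination h
    exact (mul_ne_zero h2' hs0) this

lemma exists_eq_algebraMap_of_mul_self (h2 : (2 : F) ≠ 0) (hi : IsSquare (-1 : F)) {g : SL(2, F)}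
    (hg : g * g = -1) {x : L} (hx : g • (x : OnePoint L) = x) : ∃ c : F, x = algebraMap F L c := by
  obtain ⟨i, hi⟩ := hi
  have hdet := det_eq_one_fin_two g
  have htr := trace_eq_zero_of_mul_self hg
  rw [htr] at hdet
  rw [mobius_smul_coe_eq_self_iff, htr] at hx
  have hdet' := congrArg (algebraMap F L) hdet
  have hi' := congrArg (algebraMap F L) hi
  simp only [map_sub, map_mul, map_neg, map_one] at hx hdet' hi'
  by_cases hc : g 1 0 = 0
  · have ha : g 0 0 ≠ 0 := by
      intro h
      simp [hc, h] at hdet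
    have ha' := (map_ne_zero_iff _ (algebraMap F L).injective).2 (mul_ne_zero h2 ha)
    refine ⟨-g 0 1 / (2 * g 0 0), ?_⟩
    rw [map_div₀, eq_div_iff ha']
    simp only [hc, map_zero, map_mul, map_neg, map_ofNat] at hx ⊢
    linear_combination -hx
  · have hc' := (map_ne_zero_iff _ (algebraMap F L).injective).2 hc
    have : (algebraMap F L (g 1 0) * x - algebraMap F L (g 0 0) - algebraMap F L i) *
        (algebraMap F L (g 1 0) * x - algebraMap F L (g 0 0) + algebraMap F L i) = 0 := by
      linear_combination algebraMap F L (g 1 0) * hx + hi' - hdet'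
    rcases mul_eq_zero.1 this with h | h
    · refine ⟨(g 0 0 + i) / g 1 0, ?_⟩
      rw [map_div₀, eq_div_iff hc', map_add]
      linear_combination h
    · refine ⟨(g 0 0 - i) / g 1 0, ?_⟩
      rw [map_div₀, eq_div_iff hc', map_sub]
      linear_combination h

/-- A `p'`-subgroup of `SL₂(F)` acting transitively on the projective line over `F`, with
`|F| ≡ 1 mod 4`, exists only for `|F| = 5` or `|F| = 29`. -/
theorem card_eq_five_or_twentynine [Finite F] (p : ℕ) [Fact p.Prime] [CharP F p]
    (hq : Nat.card F % 4 = 1) (H : Subgroup SL(2, F)) (hH : ¬ p ∣ Nat.card H)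
    (htrans : ∀ g : SL(2, F), ∃ h ∈ H, (h⁻¹ * g) 1 0 = 0) :
    Nat.card F = 5 ∨ Nat.card F = 29 := by
  have := Fintype.ofFinite F
  have h2 : (2 : F) ≠ 0 := by
    refine Ring.two_ne_zero fun h ↦ ?_
    rw [FiniteField.even_card_iff_char_two, ← Nat.card_eq_fintype_card] at h
    omega
  have hi : IsSquare (-1 : F) := by
    rw [FiniteField.isSquare_neg_one_iff, ← Nat.card_eq_fintype_card]
    omega
  let L := AlgebraicClosure F
  have hneg : (-1 : SL(2, F)) ≠ 1 := by
    intro h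
    have := congrArg (fun g : SL(2, F) ↦ g 0 0) h
    simp at this
    exact h2 (by linear_combination -this)
  -- the orbit of infinity is the projective line over `F`
  have hex : ∀ g : SL(2, F), ∃ h : H, h • (∞ : OnePoint L) = g • (∞ : OnePoint L) := by
    intro g
    obtain ⟨h, hh, hg⟩ := htrans g
    refine ⟨⟨h, hh⟩, ?_⟩
    rw [← mobius_smul_infty_eq_self_iff (L := L), mul_smul, inv_smul_eq_iff] at hg
    exact hg.symm
  have horb : orbit H (∞ : OnePoint L) = Set.range (OnePoint.map (algebraMap F L)) := by
    ext x
    constructor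
    · rintro ⟨h, rfl⟩
      by_cases hc : (h : SL(2, F)) 1 0 = 0
      · exact ⟨∞, (mobius_smul_infty_eq_self_iff.2 hc).symm⟩
      · exact ⟨((h : SL(2, F)) 0 0 / (h : SL(2, F)) 1 0 : F),
          (mobius_smul_infty_of_ne hc).symm⟩
    · rintro ⟨x, rfl⟩
      cases x with
      | infty => exact mem_orbit_self _
      | coe c =>
        obtain ⟨h, hh⟩ := hex ⟨!![c, -1; 1, 0], by simp⟩
        refine ⟨h, hh.trans ((mobius_smul_infty_of_ne ?_).trans ?_)⟩
        · simp
        · simp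
  have hcard : (orbit H (∞ : OnePoint L)).ncard = Nat.card F + 1 := by
    rw [horb, ← Nat.card_coe_set_eq, Nat.card_range_of_injective]
    · exact Finite.card_option
    · exact Option.map_injective (algebraMap F L).injective
  have hHcard : ∀ x : OnePoint L,
      (orbit H x).ncard * Nat.card (stabilizer H x) = Nat.card H := fun x ↦ by
    rw [← Nat.card_coe_set_eq, ← Nat.card_prod]
    exact Nat.card_congr (orbitProdStabilizerEquivGroup H x)
  have hnegH : (-1 : SL(2, F)) ∈ H := by
    have h2H : 2 ∣ Nat.card H := by
      rw [← hHcard ∞, hcard]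
      exact Dvd.dvd.mul_right (by omega) _
    obtain ⟨g, hg⟩ := exists_prime_orderOf_dvd_card' 2 h2H
    have hgg : g ^ 2 = 1 := orderOf_dvd_iff_pow_eq_one.1 hg.dvd
    rcases eq_one_or_eq_neg_one_of_mul_self h2 (g := g)
      (by simpa [pow_two, Subtype.ext_iff] using hgg) with h | h
    · have : g = 1 := Subtype.ext h
      simp [this] at hg
    · exact h ▸ g.2
  let z : H := ⟨-1, hnegH⟩
  have hz2 : z ^ 2 = 1 := Subtype.ext (by simp [z])
  have hz1 : z ≠ 1 := fun h ↦ hneg (congrArg Subtype.val h)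
  have hz : orderOf z = 2 := orderOf_eq_prime hz2 hz1
  have hzsmul : ∀ x : OnePoint L, z • x = x := neg_one_mobius_smul
  have hzc : ∀ h : H, h * z = z * h := fun h ↦ Subtype.ext (by simp [z])
  have hnormal : (Subgroup.zpowers z).Normal := by
    refine ⟨fun n hn g ↦ ?_⟩
    obtain ⟨k, rfl⟩ := hn
    have : Commute g (z ^ k) := Commute.zpow_right (hzc g) k
    exact ⟨k, by simp [this.eq]⟩
  have hmemZ : ∀ h : H, (h : SL(2, F)) = 1 ∨ (h : SL(2, F)) = -1 → h ∈ Subgroup.zpowers z := by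
    rintro h (hh | hh)
    · rw [show h = 1 from Subtype.ext hh]
      exact one_mem _
    · rw [show h = z from Subtype.ext hh]
      exact Subgroup.mem_zpowers z
  have hfix : ∀ h ∉ Subgroup.zpowers z, (fixedBy (OnePoint L) h).ncard = 2 := by
    intro h hh
    refine ncard_fixedBy_mobius (g := h) h2 fun htr ↦ hh (hmemZ h ?_)
    exact eq_one_or_eq_neg_one_of_trace_sq p h2 hH
      (congrArg Subtype.val (pow_card_eq_one' (x := h))) htr
  have hnotMem : ∀ g : H, (g : SL(2, F)) * g = -1 → g ∉ Subgroup.zpowers z := by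
    rintro g hg ⟨k, rfl⟩
    apply hneg
    rw [← hg]
    have : z ^ k * z ^ k = 1 := by
      rw [← (Commute.refl z).mul_zpow, ← pow_two, hz2, one_zpow]
    exact congrArg Subtype.val this
  have hmemOrb : ∀ (g : H) (x : OnePoint L), (g : SL(2, F)) * g = -1 → g • x = x →
      x ∈ orbit H (∞ : OnePoint L) := by
    intro g x hg hx
    rw [horb]
    cases x with
    | infty => exact ⟨∞, rfl⟩
    | coe x =>
      obtain ⟨c, rfl⟩ := exists_eq_algebraMap_of_mul_self h2 hi hg hx
      exact ⟨c, rfl⟩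
  have hstab : ∀ x ∉ orbit H (∞ : OnePoint L), ¬ 4 ∣ Nat.card (stabilizer H x) := by
    intro x hx h4
    obtain ⟨g, hg, hgg⟩ := exists_mul_self_eq_neg_one h2 ((stabilizer H x).map H.subtype)
      (by rwa [Subgroup.card_map_of_injective H.subtype_injective])
    obtain ⟨g, hgx, rfl⟩ := hg
    exact hx (hmemOrb g x hgg hgx)
  have h4 : 4 ∣ Nat.card (stabilizer H (∞ : OnePoint L)) := by
    have h2s : 2 ∣ Nat.card (stabilizer H (∞ : OnePoint L)) := by
      have := Subgroup.card_dvd_of_le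
        (Subgroup.zpowers_le.2 (show z ∈ stabilizer H (∞ : OnePoint L) from hzsmul ∞))
      rwa [Nat.card_zpowers, hz] at this
    have h4H : 4 ∣ Nat.card H := by
      rw [← hHcard ∞, hcard]
      exact mul_dvd_mul (a := 2) (c := 2) (by omega) h2s
    obtain ⟨g, hgH, hgg⟩ := exists_mul_self_eq_neg_one h2 H h4H
    obtain ⟨x, hx⟩ : (fixedBy (OnePoint L) (⟨g, hgH⟩ : H)).Nonempty := by
      apply Set.nonempty_of_ncard_ne_zero
      rw [hfix _ (hnotMem _ hgg)]
      exact two_ne_zero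
    obtain ⟨h, rfl⟩ := hmemOrb ⟨g, hgH⟩ x hgg hx
    have hs : h⁻¹ * ⟨g, hgH⟩ * h ∈ stabilizer H (∞ : OnePoint L) := by
      rw [mem_stabilizer_iff, mul_smul, mul_smul, inv_smul_eq_iff]
      exact hx
    have hsq : (h⁻¹ * ⟨g, hgH⟩ * h) ^ 2 = z := by
      have : (⟨g, hgH⟩ : H) * ⟨g, hgH⟩ = z := Subtype.ext hgg
      calc (h⁻¹ * ⟨g, hgH⟩ * h) ^ 2 = h⁻¹ * (⟨g, hgH⟩ * ⟨g, hgH⟩) * h := by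
            rw [pow_two]; group
        _ = z := by rw [this, mul_assoc, ← hzc]; group
    have hord : orderOf (h⁻¹ * ⟨g, hgH⟩ * h) = 2 ^ (1 + 1) := by
      apply orderOf_eq_prime_pow
      · rwa [pow_one, hsq]
      · rw [pow_add, pow_one, pow_mul, hsq, hz2]
    rw [show 4 = 2 ^ (1 + 1) from rfl, ← hord, ← Nat.card_zpowers]
    exact Subgroup.card_dvd_of_le (Subgroup.zpowers_le.2 hs)
  have := ncard_orbit_eq_six_or_thirty (Subgroup.zpowers z) (by rw [Nat.card_zpowers, hz])
    (fun y hy x ↦ ?_) hfix (∞ : OnePoint L) ?_ h4 hstab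
  · omega
  · obtain ⟨k, rfl⟩ := hy
    exact zpow_mem (K := stabilizer H x) (hzsmul x) k
  · have := Finite.one_lt_card (α := F)
    omega

end SpecialLinear

section LaurentSeries

variable {F : Type*} [Field F]

lemma mem_laurentIntegers_iff {x : LaurentSeries F} :
    x ∈ laurentIntegers F ↔ 0 ≤ HahnSeries.addVal ℤ F x := by
  rw [HahnSeries.addVal_apply, ← WithTop.coe_zero]
  constructor
  · rintro ⟨f, rfl⟩
    refine HahnSeries.le_orderTop_iff_forall.2 fun i hi ↦ ?_
    rw [PowerSeries.coeff_coe, if_pos (WithTop.coe_lt_coe.1 hi)]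
  · intro h
    refine ⟨PowerSeries.mk fun n ↦ x.coeff n, ?_⟩
    ext i
    rw [PowerSeries.coeff_coe]
    split_ifs with hi
    · exact (HahnSeries.coeff_eq_zero_of_lt_orderTop ((WithTop.coe_lt_coe.2 hi).trans_le h)).symm
    · rw [PowerSeries.coeff_mk, Int.natCast_natAbs, abs_of_nonneg (not_lt.1 hi)]

lemma addVal_laurentVar : HahnSeries.addVal ℤ F (laurentVar F) = ((1 : ℤ) : WithTop ℤ) := by
  rw [HahnSeries.addVal_apply, laurentVar, HahnSeries.ofPowerSeries_X,
    HahnSeries.orderTop_single one_ne_zero]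

lemma laurentVar_ne_zero : laurentVar F ≠ 0 := by
  intro h
  have := addVal_laurentVar (F := F)
  simp [h] at this

lemma laurentVar_mul_mem_iff {x : LaurentSeries F} : laurentVar F * x ∈ laurentIntegers F ↔
    ((-1 : ℤ) : WithTop ℤ) ≤ HahnSeries.addVal ℤ F x := by
  rw [mem_laurentIntegers_iff, AddValuation.map_mul, addVal_laurentVar]
  generalize HahnSeries.addVal ℤ F x = t
  cases t with
  | top => simp
  | coe t => norm_cast; omega

lemma exists_eq_laurentVar_mul_iff {x : LaurentSeries F} :
    (∃ y ∈ laurentIntegers F, x = laurentVar F * y) ↔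
      ((1 : ℤ) : WithTop ℤ) ≤ HahnSeries.addVal ℤ F x := by
  have key : ∀ y, 0 ≤ HahnSeries.addVal ℤ F y ↔
      ((1 : ℤ) : WithTop ℤ) ≤ HahnSeries.addVal ℤ F (laurentVar F * y) := by
    intro y
    rw [AddValuation.map_mul, addVal_laurentVar]
    generalize HahnSeries.addVal ℤ F y = t
    cases t with
    | top => simp
    | coe t => norm_cast; omega
  constructor
  · rintro ⟨y, hy, rfl⟩
    exact (key y).1 (mem_laurentIntegers_iff.1 hy)
  · intro h
    have hx : x = laurentVar F * ((laurentVar F)⁻¹ * x) :=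
      (mul_inv_cancel_left₀ laurentVar_ne_zero x).symm
    exact ⟨_, mem_laurentIntegers_iff.2 ((key _).2 (hx ▸ h)), hx⟩

lemma mem_parahoricOne_iff {g : SL(2, LaurentSeries F)} :
    g ∈ parahoricOne F ↔ g ∈ parahoricOneOf (HahnSeries.addVal ℤ F) := by
  simp only [parahoricOne, Set.mem_ofPred_eq, mem_parahoricOneOf, mem_laurentIntegers_iff,
    Fin.forall_fin_two, and_assoc]

lemma mem_parahoricTwo_iff {g : SL(2, LaurentSeries F)} :
    g ∈ parahoricTwo F ↔ g ∈ parahoricTwoOf (HahnSeries.addVal ℤ F) := by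
  simp only [parahoricTwo, Set.mem_ofPred_eq, mem_parahoricTwoOf, laurentVar_mul_mem_iff,
    exists_eq_laurentVar_mul_iff]
  rw [mem_laurentIntegers_iff, mem_laurentIntegers_iff]
  tauto

lemma mem_iwahori_iff {g : SL(2, LaurentSeries F)} : g ∈ iwahori F ↔
    g ∈ parahoricOneOf (HahnSeries.addVal ℤ F) ⊓ parahoricTwoOf (HahnSeries.addVal ℤ F) := by
  rw [Subgroup.mem_inf, ← mem_parahoricOne_iff, ← mem_parahoricTwo_iff]
  rfl

/-- The integral points of a subgroup of `SL₂(F((u)))`, as a subgroup of `SL₂(F[[u]])`. -/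
noncomputable def integralPoints (A : Subgroup SL(2, LaurentSeries F)) :
    Subgroup SL(2, PowerSeries F) :=
  A.comap (Matrix.SpecialLinearGroup.map (HahnSeries.ofPowerSeries ℤ F))

lemma map_ofPowerSeries_mem_parahoricOne (g : SL(2, PowerSeries F)) :
    Matrix.SpecialLinearGroup.map (HahnSeries.ofPowerSeries ℤ F) g ∈ parahoricOne F :=
  fun i j ↦ ⟨g i j, rfl⟩

lemma map_ofPowerSeries_injective : Function.Injective
    (Matrix.SpecialLinearGroup.map (n := Fin 2) (HahnSeries.ofPowerSeries ℤ F)) := by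
  intro g h hgh
  ext1 i j
  exact HahnSeries.ofPowerSeries_injective (congrArg (fun k : SL(2, LaurentSeries F) ↦ k i j) hgh)

lemma exists_map_ofPowerSeries_eq {g : SL(2, LaurentSeries F)} (hg : g ∈ parahoricOne F) :
    ∃ h, Matrix.SpecialLinearGroup.map (HahnSeries.ofPowerSeries ℤ F) h = g := by
  choose f hf using hg
  refine ⟨⟨Matrix.of f, ?_⟩, ?_⟩
  · apply HahnSeries.ofPowerSeries_injective (Γ := ℤ) (R := F)
    rw [RingHom.map_det, map_one, ← g.det_coe]
    congr 1
    ext1 i j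
    exact hf i j
  · ext1 i j
    exact hf i j

/-- The image in `SL₂(F)` of the integral points of a subgroup of `SL₂(F((u)))`. -/
noncomputable def residueImage (A : Subgroup SL(2, LaurentSeries F)) : Subgroup SL(2, F) :=
  (integralPoints A).map (Matrix.SpecialLinearGroup.map PowerSeries.constantCoeff)

lemma card_residueImage_dvd (A : Subgroup SL(2, LaurentSeries F)) :
    Nat.card (residueImage A) ∣ Nat.card A :=
  (Subgroup.card_map_dvd _ _).trans
    (Subgroup.card_comap_dvd_of_injective _ _ map_ofPowerSeries_injective)

lemma exists_mem_residueImage {A : Subgroup SL(2, LaurentSeries F)}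
    (hA : (A : Set SL(2, LaurentSeries F)) ⊆ parahoricOne F)
    (h : ∀ g ∈ parahoricOne F, ∃ x ∈ A, ∃ b ∈ iwahori F, g = x * b) (g : SL(2, F)) :
    ∃ h ∈ residueImage A, (h⁻¹ * g) 1 0 = 0 := by
  let g' : SL(2, PowerSeries F) := Matrix.SpecialLinearGroup.map PowerSeries.C g
  obtain ⟨x, hx, b, hb, hxb⟩ := h _ (map_ofPowerSeries_mem_parahoricOne g')
  obtain ⟨x, rfl⟩ := exists_map_ofPowerSeries_eq (hA hx)
  obtain ⟨b, rfl⟩ := exists_map_ofPowerSeries_eq hb.1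
  rw [← map_mul] at hxb
  have hg' := map_ofPowerSeries_injective hxb
  have hg : Matrix.SpecialLinearGroup.map PowerSeries.constantCoeff g' = g := by
    ext1 i j
    simp [g']
  refine ⟨_, ⟨x, hx, rfl⟩, ?_⟩
  rw [← hg, hg', map_mul, inv_mul_cancel_left]
  obtain ⟨-, -, -, y, ⟨y, rfl⟩, hy⟩ := hb.2
  have : b 1 0 = PowerSeries.X * y := by
    apply HahnSeries.ofPowerSeries_injective (Γ := ℤ) (R := F)
    rw [map_mul]
    exact hy
  simp [this]

end LaurentSeries

end

/-- Let `p` be an odd prime, `q = p^a ≡ 1 (mod 4)` with `q ∉ {5, 29}`,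
`K = 𝔽_q((u))`, and `P₁, P₂, B` the standard parahoric and Iwahori subgroups of `SL₂(K)`.
Then there are no finite subgroups `A₁ ≤ P₁`, `A₂ ≤ P₂` with `P_i = A_i · B` and
`A_i ∩ P_{3-i} = A₁ ∩ A₂` for `i = 1, 2`. -/
theorem no_edge_transitive_lattice_q_one_mod_four (p a : ℕ) [Fact p.Prime]
    (hodd : Odd p) (ha : 1 ≤ a) (hq : p ^ a % 4 = 1)
    (hq5 : p ^ a ≠ 5) (hq29 : p ^ a ≠ 29) :
    ¬ ∃ A₁ A₂ : Subgroup (Matrix.SpecialLinearGroup (Fin 2)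
        (LaurentSeries (GaloisField p a))),
      Finite A₁ ∧ Finite A₂ ∧
      (↑A₁ : Set _) ⊆ parahoricOne (GaloisField p a) ∧
      (↑A₂ : Set _) ⊆ parahoricTwo (GaloisField p a) ∧
      (∀ g ∈ parahoricOne (GaloisField p a),
        ∃ x ∈ A₁, ∃ b ∈ iwahori (GaloisField p a), g = x * b) ∧
      (∀ g ∈ parahoricTwo (GaloisField p a),
        ∃ x ∈ A₂, ∃ b ∈ iwahori (GaloisField p a), g = x * b) ∧
      (↑A₁ : Set _) ∩ parahoricTwo (GaloisField p a) = ↑(A₁ ⊓ A₂) ∧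
      (↑A₂ : Set _) ∩ parahoricOne (GaloisField p a) = ↑(A₁ ⊓ A₂) := by
  rintro ⟨A₁, A₂, _, _, hA₁, hA₂, h₁, h₂, h₁₂, h₂₁⟩
  have hcard : Nat.card (GaloisField p a) = p ^ a := GaloisField.card p a (by omega)
  have : CharP (LaurentSeries (GaloisField p a)) p :=
    charP_of_injective_ringHom (HahnSeries.C_injective (Γ := ℤ) (R := GaloisField p a)) p
  have hp : ¬ p ∣ Nat.card A₁ := by
    intro hdvd
    obtain ⟨g, hg⟩ := exists_prime_orderOf_dvd_card' p hdvd
    have hg1 : (g : Matrix.SpecialLinearGroup (Fin 2) (LaurentSeries (GaloisField p a))) = 1 := by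
      refine eq_one_of_pow_char_eq_one p (v := HahnSeries.addVal ℤ (GaloisField p a))
        addVal_laurentVar (A₁ := A₁) (A₂ := A₂) (fun x hx ↦ mem_parahoricOne_iff.1 (hA₁ hx))
        (fun x hx ↦ mem_parahoricTwo_iff.1 (hA₂ hx)) ?_ ?_ ?_ ?_ g.2 ?_
      · rintro x ⟨hx, hx'⟩
        exact (h₁₂.subset ⟨hx, mem_parahoricTwo_iff.2 hx'⟩).2
      · rintro x ⟨hx, hx'⟩
        exact (h₂₁.subset ⟨hx, mem_parahoricOne_iff.2 hx'⟩).1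
      · simpa only [← mem_parahoricOne_iff, ← mem_iwahori_iff] using h₁
      · simpa only [← mem_parahoricTwo_iff, ← mem_iwahori_iff] using h₂
      · exact congrArg Subtype.val (orderOf_dvd_iff_pow_eq_one.1 hg.dvd)
    have hg1 : g = 1 := Subtype.ext hg1
    rw [hg1, orderOf_one] at hg
    exact (Fact.out : p.Prime).one_lt.ne hg
  have := card_eq_five_or_twentynine p (hcard ▸ hq) (residueImage A₁)
    (fun h ↦ hp (h.trans (card_residueImage_dvd A₁))) (exists_mem_residueImage hA₁ h₁)
  omega
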